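/- Let k ≥ 2 be an even integer. There exist open neighbourhoods U_0, V_0 of the origin of ℝ^k and open subsets Ω_1 ⊆ Ω̃ ⊆ V_0 such that: for every s ∈ Ω̃ the equation w_k(t) = s has at least one solution t ∈ U_0; for every s ∈ Ω_1 the equation w_k(t) = s has exactly one solution t ∈ U_0 and this solution is a regular point of w_k; and the origin belongs to the topological boundary of Ω_1 (in particular Ω_1 is non-empty). -/

import Mathlib

/-- The Whitney map `w_k : ℝ^k → ℝ^k`. -/
noncomputable def whitney (k : ℕ) (hk : 0 < k) (x : Fin k → ℝ) : Fin k → ℝ :=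
  fun j => if (j : ℕ) = 0 then
      (x ⟨0, hk⟩) ^ (k + 1) +
        ∑ i : Fin k, (if (i : ℕ) = 0 then 0 else x i * (x ⟨0, hk⟩) ^ (i : ℕ))
    else x j

/-- A differentiable real function whose derivative is bounded below by a positive constant is a
bijection of the line. -/
theorem bijective_of_forall_le_deriv {f : ℝ → ℝ} {c : ℝ} (hf : Differentiable ℝ f) (hc : 0 < c)
    (h : ∀ x, c ≤ deriv f x) : Function.Bijective f := by
  refine ⟨(strictMono_of_deriv_pos fun x => hc.trans_le (h x)).injective,
    hf.continuous.surjective ?_ ?_⟩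
  · refine Filter.tendsto_atTop_mono' _ ?_
      (Filter.tendsto_atTop_add_const_right _ (f 0) (Filter.tendsto_id.const_mul_atTop hc))
    filter_upwards [Filter.eventually_ge_atTop 0] with x hx
    have := mul_sub_le_image_sub_of_le_deriv hf h hx
    simp only [id]
    linarith
  · refine Filter.tendsto_atBot_mono' _ ?_
      (Filter.tendsto_atBot_add_const_right _ (f 0) (Filter.tendsto_id.const_mul_atBot hc))
    filter_upwards [Filter.eventually_le_atBot 0] with x hx
    have := mul_sub_le_image_sub_of_le_deriv hf h hx
    simp only [id]
    linarith

/-- The first component of the Whitney map as a polynomial function of its first variable, the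
other variables being the entries `s i`, `i ≠ 0`. -/
noncomputable def whitneyPoly {k : ℕ} (s : Fin k → ℝ) (r : ℝ) : ℝ :=
  r ^ (k + 1) + ∑ i : Fin k, if (i : ℕ) = 0 then 0 else s i * r ^ (i : ℕ)

theorem whitneyPoly_congr {k : ℕ} {s t : Fin k → ℝ} (h : ∀ i : Fin k, (i : ℕ) ≠ 0 → s i = t i) :
    whitneyPoly s = whitneyPoly t := by
  ext r
  unfold whitneyPoly
  congr 1
  refine Finset.sum_congr rfl fun i _ => ?_
  split_ifs with hi
  · rfl
  · rw [h i hi]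

theorem whitney_apply_zero {k : ℕ} (hk : 0 < k) (x : Fin k → ℝ) :
    whitney k hk x ⟨0, hk⟩ = whitneyPoly x (x ⟨0, hk⟩) := by
  simp [whitney, whitneyPoly]

theorem whitney_apply_of_ne {k : ℕ} (hk : 0 < k) (x : Fin k → ℝ) {j : Fin k} (hj : (j : ℕ) ≠ 0) :
    whitney k hk x j = x j := by
  simp [whitney, hj]

theorem differentiable_whitney {k : ℕ} (hk : 0 < k) : Differentiable ℝ (whitney k hk) := by
  refine differentiable_pi.2 fun j => ?_
  by_cases hj : (j : ℕ) = 0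
  · simp only [whitney, hj, if_true]
    refine Differentiable.add (by fun_prop) (Differentiable.fun_sum fun i _ => ?_)
    split_ifs <;> fun_prop
  · simp only [whitney, hj, if_false]
    fun_prop

theorem hasDerivAt_whitneyPoly {k : ℕ} (s : Fin k → ℝ) (r : ℝ) :
    HasDerivAt (whitneyPoly s)
      ((k + 1) * r ^ k + ∑ i : Fin k, (i : ℕ) * s i * r ^ ((i : ℕ) - 1)) r := by
  unfold whitneyPoly
  refine HasDerivAt.add (by simpa using hasDerivAt_pow (k + 1) r)
    (HasDerivAt.fun_sum fun i _ => ?_)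
  split_ifs with hi
  · simpa [hi] using hasDerivAt_const r (0 : ℝ)
  · exact ((hasDerivAt_pow (i : ℕ) r).const_mul (s i)).congr_deriv (by ring)

/-- The equation `whitney k hk t = s` reduces to a polynomial equation in one variable. -/
theorem whitney_eq_iff {k : ℕ} (hk : 0 < k) (t s : Fin k → ℝ) :
    whitney k hk t = s ↔ (∀ i : Fin k, (i : ℕ) ≠ 0 → t i = s i) ∧
      whitneyPoly s (t ⟨0, hk⟩) = s ⟨0, hk⟩ := by
  constructor
  · intro h
    have h' : ∀ i : Fin k, (i : ℕ) ≠ 0 → t i = s i := fun i hi => by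
      rw [← h, whitney_apply_of_ne hk t hi]
    refine ⟨h', ?_⟩
    rw [← whitneyPoly_congr h', ← whitney_apply_zero, h]
  · rintro ⟨h', h⟩
    ext j
    by_cases hj : (j : ℕ) = 0
    · obtain rfl : j = ⟨0, hk⟩ := Fin.ext hj
      rw [whitney_apply_zero, whitneyPoly_congr h', h]
    · rw [whitney_apply_of_ne hk t hj, h' j hj]

/-- The Whitney map is regular at every point where its first component has a nonzero partial
derivative in the first variable. -/
theorem bijective_fderiv_whitney {k : ℕ} (hk : 0 < k) (t : Fin k → ℝ)
    (h : deriv (whitneyPoly t) (t ⟨0, hk⟩) ≠ 0) :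
    Function.Bijective (fderiv ℝ (whitney k hk) t) := by
  set L := fderiv ℝ (whitney k hk) t with hL
  have hw : HasFDerivAt (whitney k hk) L t := (differentiable_whitney hk t).hasFDerivAt
  suffices hinj : Function.Injective L from
    ⟨hinj, (LinearMap.injective_iff_surjective (f := (L : (Fin k → ℝ) →ₗ[ℝ] Fin k → ℝ))).1 hinj⟩
  refine (injective_iff_map_eq_zero L).2 fun v hv => ?_
  have hne : ∀ j : Fin k, (j : ℕ) ≠ 0 → v j = 0 := fun j hj => by
    have h1 : HasFDerivAt (fun x => whitney k hk x j) _ t := hasFDerivAt_pi'.1 hw j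
    have h2 : HasFDerivAt (fun x => whitney k hk x j)
        (ContinuousLinearMap.proj (R := ℝ) (φ := fun _ : Fin k => ℝ) j) t := by
      simp only [whitney_apply_of_ne hk _ hj]
      exact hasFDerivAt_apply j t
    have := congrArg (fun l => l v) (h1.unique h2)
    simpa [hv] using this.symm
  have hvs : v = v ⟨0, hk⟩ • Pi.single ⟨0, hk⟩ 1 := by
    ext j
    by_cases hj : (j : ℕ) = 0
    · obtain rfl : j = ⟨0, hk⟩ := Fin.ext hj
      simp
    · have : j ≠ ⟨0, hk⟩ := fun hj' => hj (congrArg Fin.val hj')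
      simp [hne j hj, this]
  have hpartial : L (Pi.single ⟨0, hk⟩ 1) ⟨0, hk⟩ = deriv (whitneyPoly t) (t ⟨0, hk⟩) := by
    have hu : HasDerivAt (Function.update t ⟨0, hk⟩) _ (t ⟨0, hk⟩) :=
      hasDerivAt_update t ⟨0, hk⟩ (t ⟨0, hk⟩)
    have h1 := hasDerivAt_pi.1
      (HasFDerivAt.comp_hasDerivAt_of_eq (t ⟨0, hk⟩) hw hu (by simp)) ⟨0, hk⟩
    rw [← h1.deriv]
    congr 1
    ext r
    have hcongr : whitneyPoly (Function.update t ⟨0, hk⟩ r) = whitneyPoly t :=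
      whitneyPoly_congr fun i hi =>
        Function.update_of_ne (fun hi' => hi (congrArg Fin.val hi')) _ _
    simp [whitney_apply_zero, hcongr]
  have hv0 : v ⟨0, hk⟩ = 0 := by
    have := congrFun hv ⟨0, hk⟩
    rw [hvs, map_smul] at this
    simpa [hpartial, h] using this
  rw [hvs, hv0, zero_smul]

/-- Lower bound for the derivative when the linear coefficient dominates the higher ones. -/
theorem le_deriv_whitneyPoly {k : ℕ} (hk : 1 < k) (heven : Even k) (s : Fin k → ℝ)
    (h : ∑ i : Fin k, (if (i : ℕ) ≤ 1 then 0 else (i : ℕ) * |s i|) ≤ 1) (r : ℝ) :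
    s ⟨1, hk⟩ - ∑ i : Fin k, (if (i : ℕ) ≤ 1 then 0 else (i : ℕ) * |s i|) ≤
      deriv (whitneyPoly s) r := by
  rw [(hasDerivAt_whitneyPoly s r).deriv]
  set S := ∑ i : Fin k, (if (i : ℕ) ≤ 1 then 0 else (i : ℕ) * |s i|) with hS
  have hr : 0 ≤ r ^ k := heven.pow_nonneg r
  have hpow : ∀ n ≤ k, |r| ^ n ≤ 1 + r ^ k := fun n hn => by
    rw [← heven.pow_abs]
    rcases le_total |r| 1 with h1 | h1
    · exact (pow_le_one₀ (abs_nonneg r) h1).trans (by simp)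
    · exact (pow_le_pow_right₀ h1 hn).trans (by simp)
  have hterm : ∑ i : Fin k, (if i = ⟨1, hk⟩ then s i else 0) - S * (1 + r ^ k) ≤
      ∑ i : Fin k, (i : ℕ) * s i * r ^ ((i : ℕ) - 1) := by
    rw [hS, Finset.sum_mul, ← Finset.sum_sub_distrib]
    refine Finset.sum_le_sum fun i _ => ?_
    by_cases h1 : (i : ℕ) = 1
    · simp [Fin.ext_iff, h1]
    by_cases h0 : (i : ℕ) = 0
    · simp [Fin.ext_iff, h0]
    have hle : ¬ (i : ℕ) ≤ 1 := by omega
    simp only [Fin.ext_iff, h1, if_false, hle, zero_sub]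
    refine (neg_le_neg ?_).trans (neg_abs_le _)
    rw [abs_mul, abs_mul, abs_pow, Nat.abs_cast]
    exact mul_le_mul_of_nonneg_left (hpow _ (by omega)) (by positivity)
  rw [Finset.sum_ite_eq' Finset.univ, if_pos (Finset.mem_univ _)] at hterm
  have : S * r ^ k ≤ r ^ k := mul_le_of_le_one_left hr h
  have : 0 ≤ (k : ℝ) * r ^ k := by positivity
  linarith

/-- Let `k ≥ 2` be even.  There exist open neighbourhoods `U₀, V₀` of the
origin of `ℝ^k` and open subsets `Ω₁ ⊆ Ω̃ ⊆ V₀` such that: for every `s ∈ Ω̃` the equation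
`w_k t = s` has at least one solution `t ∈ U₀`; for every `s ∈ Ω₁` the equation `w_k t = s`
has exactly one solution `t ∈ U₀` and this solution is a regular point of `w_k`; and the
origin belongs to the topological boundary of `Ω₁` (in particular `Ω₁` is non-empty). -/
theorem whitney_unique_solution_region (k : ℕ) (hk : 2 ≤ k) (heven : Even k) :
    ∃ U₀ V₀ : Set (Fin k → ℝ), IsOpen U₀ ∧ IsOpen V₀ ∧
      (0 : Fin k → ℝ) ∈ U₀ ∧ (0 : Fin k → ℝ) ∈ V₀ ∧
      ∃ Ω₁ Ωt : Set (Fin k → ℝ), Ω₁ ⊆ Ωt ∧ Ωt ⊆ V₀ ∧ IsOpen Ω₁ ∧ IsOpen Ωt ∧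
        (∀ s ∈ Ωt, ∃ t ∈ U₀, whitney k (by omega) t = s) ∧
        (∀ s ∈ Ω₁, ∃ t : Fin k → ℝ, t ∈ U₀ ∧ whitney k (by omega) t = s ∧
          Function.Bijective (⇑(fderiv ℝ (whitney k (by omega)) t)) ∧
          ∀ t' : Fin k → ℝ, t' ∈ U₀ → whitney k (by omega) t' = s → t' = t) ∧
        (0 : Fin k → ℝ) ∈ frontier Ω₁ := by
  have h0 : 0 < k := by omega
  have h1 : 1 < k := hk
  let S : (Fin k → ℝ) → ℝ := fun s => ∑ i : Fin k, (if (i : ℕ) ≤ 1 then 0 else (i : ℕ) * |s i|)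
  have hScont : Continuous S := by
    refine continuous_finsetSum _ fun i _ => ?_
    split_ifs <;> fun_prop
  let Ω : Set (Fin k → ℝ) := {s | S s < s ⟨1, h1⟩} ∩ {s | s ⟨1, h1⟩ < 1}
  have hΩ : IsOpen Ω := (isOpen_lt hScont (by fun_prop)).inter (isOpen_lt (by fun_prop) (by fun_prop))
  have hderiv : ∀ s ∈ Ω, ∀ r, s ⟨1, h1⟩ - S s ≤ deriv (whitneyPoly s) r := fun s hs r =>
    le_deriv_whitneyPoly h1 heven s (hs.1.trans hs.2).le r
  have hunique : ∀ s ∈ Ω, ∃ t : Fin k → ℝ, t ∈ Set.univ ∧ whitney k h0 t = s ∧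
      Function.Bijective (⇑(fderiv ℝ (whitney k h0) t)) ∧
      ∀ t' : Fin k → ℝ, t' ∈ Set.univ → whitney k h0 t' = s → t' = t := by
    intro s hs
    have hpos : 0 < s ⟨1, h1⟩ - S s := sub_pos.2 hs.1
    have hbij := bijective_of_forall_le_deriv
      (fun r => (hasDerivAt_whitneyPoly s r).differentiableAt) hpos (hderiv s hs)
    obtain ⟨r, hr⟩ := hbij.2 (s ⟨0, h0⟩)
    have hagree : ∀ i : Fin k, (i : ℕ) ≠ 0 → Function.update s ⟨0, h0⟩ r i = s i := fun i hi =>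
      Function.update_of_ne (fun hi' => hi (congrArg Fin.val hi')) _ _
    refine ⟨Function.update s ⟨0, h0⟩ r, trivial, ?_, ?_, fun t' _ ht' => ?_⟩
    · exact (whitney_eq_iff h0 _ _).2 ⟨hagree, by simpa using hr⟩
    · refine bijective_fderiv_whitney h0 _ ?_
      rw [whitneyPoly_congr hagree]
      exact (hpos.trans_le (hderiv s hs _)).ne'
    · obtain ⟨ht1, ht2⟩ := (whitney_eq_iff h0 _ _).1 ht'
      ext j
      by_cases hj : (j : ℕ) = 0
      · obtain rfl : j = ⟨0, h0⟩ := Fin.ext hj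
        simpa using hbij.1 (ht2.trans hr.symm)
      · rw [ht1 j hj, hagree j hj]
  refine ⟨Set.univ, Set.univ, isOpen_univ, isOpen_univ, trivial, trivial, Ω, Ω, subset_rfl,
    Set.subset_univ _, hΩ, hΩ, fun s hs => ?_, hunique, ?_⟩
  · obtain ⟨t, ht, hts, -⟩ := hunique s hs
    exact ⟨t, ht, hts⟩
  · rw [hΩ.frontier_eq]
    refine ⟨?_, fun h => by simpa [S] using h.1⟩
    have hlim : Filter.Tendsto (fun ε : ℝ => Pi.single (M := fun _ : Fin k => ℝ) ⟨1, h1⟩ ε)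
        (nhdsWithin 0 (Set.Ioi 0)) (nhds 0) := by
      have hc : Continuous fun ε : ℝ => Pi.single (M := fun _ : Fin k => ℝ) ⟨1, h1⟩ ε :=
        continuous_single (A := fun _ : Fin k => ℝ) ⟨1, h1⟩
      simpa using (hc.tendsto 0).mono_left nhdsWithin_le_nhds
    refine mem_closure_of_tendsto hlim ?_
    filter_upwards [Ioo_mem_nhdsGT (zero_lt_one (α := ℝ))] with ε hε
    have hS : S (Pi.single ⟨1, h1⟩ ε) = 0 := by
      refine Finset.sum_eq_zero fun i _ => ?_
      split_ifs with hi
      · rfl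
      · have : i ≠ ⟨1, h1⟩ := fun hi' => hi (congrArg Fin.val hi').le
        simp [this]
    refine ⟨?_, ?_⟩
    · simpa [hS] using hε.1
    · simpa using hε.2
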